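/- Let ε ∈ {1, −1} and let ξ₁, ξ₂, ξ₃, H, C and λᵢ⁺, λᵢ⁻ (i = 1, 2, 3) be real numbers such that ξ₁² + ξ₂² + ξ₃² = 1, H ≠ 0, and ξᵢ + ξⱼ ≠ 0 and ξᵢ − ξⱼ ≠ 0 for all i ≠ j. Suppose that for every cyclic permutation (i,j,k) of (1,2,3): ε·(ξⱼ + ξₖ)² = −(λᵢ⁺)² + H·λᵢ⁺ + C; ε·(ξⱼ − ξₖ)² = −(λᵢ⁻)² + H·λᵢ⁻ + C; and −ε·(ξⱼ + ξₖ)·(ξₖ + ξᵢ)·(ξᵢ − ξⱼ) = λᵢ⁺·λⱼ⁺·(ξᵢ − ξⱼ) − λₖ⁻·λᵢ⁺·(ξₖ + ξᵢ) + λⱼ⁺·λₖ⁻·(ξⱼ + ξₖ). Then 8·σ₁·σ₃ + 20·σ₁⁴ − (3Cε + 4)·σ₁² + εC − C² = 0, where σ₁ = ξ₁ + ξ₂ + ξ₃ and σ₃ = ξ₁·ξ₂·ξ₃. -/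

import Mathlib

/-- Three points on the conic `y² + ε x² = R` with vanishing sum of `x` and vanishing `∑ x y`
and `∑ x y y - ε x x x` : impossible if the `x` are nonzero. -/
theorem aux_degenerate (ε x₁ x₂ x₃ y₁ y₂ y₃ R : ℝ) (hε : ε = 1 ∨ ε = -1)
    (hs : x₃ = -x₁ - x₂) (h1 : x₁ ≠ 0) (h2 : x₂ ≠ 0) (h3 : x₃ ≠ 0)
    (g1 : y₁ ^ 2 + ε * x₁ ^ 2 = R) (g2 : y₂ ^ 2 + ε * x₂ ^ 2 = R)
    (g3 : y₃ ^ 2 + ε * x₃ ^ 2 = R)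
    (hT : x₁ * y₁ + x₂ * y₂ + x₃ * y₃ = 0)
    (hK : x₁ * y₂ * y₃ + x₂ * y₁ * y₃ + x₃ * y₁ * y₂ - ε * x₁ * x₂ * x₃ = 0) : False := by
  have he2 : ε * ε = 1 := by rcases hε with h | h <;> rw [h] <;> norm_num
  have he0 : ε ≠ 0 := by rintro rfl; norm_num at he2
  obtain ⟨k, hk⟩ : ∃ k, y₂ - y₃ = k * x₁ := ⟨(y₂ - y₃) / x₁, by field_simp⟩
  have hk' : y₁ - y₃ = -k * x₂ := by
    apply mul_left_cancel₀ h1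
    subst hs
    linear_combination hT - x₂ * hk
  have a1 : k * (y₁ + y₃) = ε * (x₃ - x₁) := by
    apply mul_left_cancel₀ h2
    subst hs
    linear_combination (y₁ + y₃) * hk' - g1 + g3
  have a2 : k * (y₂ + y₃) = -ε * (x₃ - x₂) := by
    apply mul_left_cancel₀ h1
    subst hs
    linear_combination -(y₂ + y₃) * hk + g2 - g3
  have a3 : k ^ 2 = 3 * ε := by
    apply mul_left_cancel₀ h3
    subst hs
    linear_combination a1 - a2 - k * hk' + k * hk
  have hε1 : ε = 1 := by
    rcases hε with h | h
    · exact h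
    · nlinarith [sq_nonneg k]
  subst hε1
  have b3 : 3 * y₃ = k * (x₂ - x₁) := by
    subst hs
    linear_combination (-y₃ + k*x₂/2) * a3 + k / 2 * a1 - k ^ 2 / 2 * hk'
  have b1 : y₁ = y₃ - k * x₂ := by linarith
  have b2 : y₂ = y₃ + k * x₁ := by linarith
  have b3' : y₃ = k * (x₂ - x₁) / 3 := by linarith
  have : x₁ * x₂ * x₃ = 0 := by
    subst b1 b2 b3' hs
    linear_combination -hK / 4 - x₁ * x₂ * (-x₁ - x₂) / 4 * a3
  exact mul_ne_zero (mul_ne_zero h1 h2) h3 this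

/-- In a rank two subsystem of type `A₂` the sum of the principal curvatures is determined. -/
theorem aux_triple (ε x₁ x₂ x₃ p q m H C : ℝ) (hε : ε = 1 ∨ ε = -1)
    (hs : x₃ = -x₁ - x₂) (h1 : x₁ ≠ 0) (h2 : x₂ ≠ 0) (h3 : x₃ ≠ 0)
    (g1 : ε * x₁ ^ 2 = -p ^ 2 + H * p + C) (g2 : ε * x₂ ^ 2 = -q ^ 2 + H * q + C)
    (g3 : ε * x₃ ^ 2 = -m ^ 2 + H * m + C)
    (hr : x₁ * q * m + x₂ * p * m + x₃ * p * q = ε * x₁ * x₂ * x₃) :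
    H * (p + q + m) = H ^ 2 - 2 * C := by
  obtain ⟨h, rfl⟩ : ∃ h, H = 2 * h := ⟨H / 2, by ring⟩
  obtain ⟨y₁, rfl⟩ : ∃ y, p = y + h := ⟨p - h, by ring⟩
  obtain ⟨y₂, rfl⟩ : ∃ y, q = y + h := ⟨q - h, by ring⟩
  obtain ⟨y₃, rfl⟩ : ∃ y, m = y + h := ⟨m - h, by ring⟩
  have e1 : y₁ ^ 2 + ε * x₁ ^ 2 = C + h ^ 2 := by linear_combination g1
  have e2 : y₂ ^ 2 + ε * x₂ ^ 2 = C + h ^ 2 := by linear_combination g2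
  have e3 : y₃ ^ 2 + ε * x₃ ^ 2 = C + h ^ 2 := by linear_combination g3
  have hTK : h * (x₁ * y₁ + x₂ * y₂ + x₃ * y₃)
      = x₁ * y₂ * y₃ + x₂ * y₁ * y₃ + x₃ * y₁ * y₂ - ε * x₁ * x₂ * x₃ := by
    subst hs
    linear_combination -hr
  have hYK : (y₁ + y₂ + y₃) *
      (x₁ * y₂ * y₃ + x₂ * y₁ * y₃ + x₃ * y₁ * y₂ - ε * x₁ * x₂ * x₃)
      = -(C + h ^ 2) * (x₁ * y₁ + x₂ * y₂ + x₃ * y₃) := by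
    subst hs
    linear_combination (x₂ * y₃ + (-x₁ - x₂) * y₂) * e1 + (x₁ * y₃ + (-x₁ - x₂) * y₁) * e2
      + (x₁ * y₂ + x₂ * y₁) * e3
  have hprod : (x₁ * y₁ + x₂ * y₂ + x₃ * y₃) * (C + h ^ 2 + h * (y₁ + y₂ + y₃)) = 0 := by
    linear_combination (y₁ + y₂ + y₃) * hTK + hYK
  rcases mul_eq_zero.1 hprod with hT | hR
  · exfalso
    refine aux_degenerate ε x₁ x₂ x₃ y₁ y₂ y₃ _ hε hs h1 h2 h3 e1 e2 e3 hT ?_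
    rw [← hTK, hT, mul_zero]
  · linear_combination 2 * hR

/-- Exceptional coincidence of the ratios `λ / x` is impossible. -/
theorem aux_ratio (ε x y u v m H C : ℝ) (hε : ε = 1 ∨ ε = -1) (hH : H ≠ 0)
    (hx : x ≠ 0) (hy : y ≠ 0) (hxy : y - x ≠ 0)
    (g1 : ε * x ^ 2 = -(x * u) ^ 2 + H * (x * u) + C)
    (g2 : ε * y ^ 2 = -(y * v) ^ 2 + H * (y * v) + C)
    (hr : (y - x) * (u * v + ε) = m * (u - v)) : u - v ≠ 0 := by
  intro h
  obtain rfl : u = v := by linarith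
  have hu : u * u + ε = 0 := by
    rw [h, mul_zero] at hr
    exact (mul_eq_zero.1 hr).resolve_left hxy
  have hu0 : u ≠ 0 := by
    rintro rfl
    rcases hε with h | h <;> rw [h] at hu <;> norm_num at hu
  have : H * u * (y - x) = 0 := by
    linear_combination g1 - g2 + (y ^ 2 - x ^ 2) * hu
  exact mul_ne_zero (mul_ne_zero hH hu0) hxy this

/-- the polynomial relation for the components of the unit normal obtained
by elimination in the `A₃` case of Proposition 4.1. (Here `lp i`, `lm i` stand for the
principal curvatures `λᵢ⁺`, `λᵢ⁻`.) -/
theorem stmt15 (ε ξ₁ ξ₂ ξ₃ H C lp₁ lp₂ lp₃ lm₁ lm₂ lm₃ : ℝ)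
    (hε : ε = 1 ∨ ε = -1)
    (hunit : ξ₁ ^ 2 + ξ₂ ^ 2 + ξ₃ ^ 2 = 1)
    (hH : H ≠ 0)
    (h12 : ξ₁ + ξ₂ ≠ 0) (h23 : ξ₂ + ξ₃ ≠ 0) (h31 : ξ₃ + ξ₁ ≠ 0)
    (h12' : ξ₁ - ξ₂ ≠ 0) (h23' : ξ₂ - ξ₃ ≠ 0) (h31' : ξ₃ - ξ₁ ≠ 0)
    (gp1 : ε * (ξ₂ + ξ₃) ^ 2 = -lp₁ ^ 2 + H * lp₁ + C)
    (gp2 : ε * (ξ₃ + ξ₁) ^ 2 = -lp₂ ^ 2 + H * lp₂ + C)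
    (gp3 : ε * (ξ₁ + ξ₂) ^ 2 = -lp₃ ^ 2 + H * lp₃ + C)
    (gm1 : ε * (ξ₂ - ξ₃) ^ 2 = -lm₁ ^ 2 + H * lm₁ + C)
    (gm2 : ε * (ξ₃ - ξ₁) ^ 2 = -lm₂ ^ 2 + H * lm₂ + C)
    (gm3 : ε * (ξ₁ - ξ₂) ^ 2 = -lm₃ ^ 2 + H * lm₃ + C)
    (r1 : -(ε * (ξ₂ + ξ₃) * (ξ₃ + ξ₁) * (ξ₁ - ξ₂))
        = lp₁ * lp₂ * (ξ₁ - ξ₂) - lm₃ * lp₁ * (ξ₃ + ξ₁) + lp₂ * lm₃ * (ξ₂ + ξ₃))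
    (r2 : -(ε * (ξ₃ + ξ₁) * (ξ₁ + ξ₂) * (ξ₂ - ξ₃))
        = lp₂ * lp₃ * (ξ₂ - ξ₃) - lm₁ * lp₂ * (ξ₁ + ξ₂) + lp₃ * lm₁ * (ξ₃ + ξ₁))
    (r3 : -(ε * (ξ₁ + ξ₂) * (ξ₂ + ξ₃) * (ξ₃ - ξ₁))
        = lp₃ * lp₁ * (ξ₃ - ξ₁) - lm₂ * lp₃ * (ξ₂ + ξ₃) + lp₁ * lm₂ * (ξ₁ + ξ₂)) :
    8 * (ξ₁ + ξ₂ + ξ₃) * (ξ₁ * ξ₂ * ξ₃) + 20 * (ξ₁ + ξ₂ + ξ₃) ^ 4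
      - (3 * C * ε + 4) * (ξ₁ + ξ₂ + ξ₃) ^ 2 + ε * C - C ^ 2 = 0 := by
  exfalso
  have t1 := aux_triple ε (ξ₂ + ξ₃) (-(ξ₃ + ξ₁)) (ξ₁ - ξ₂) lp₁ lp₂ lm₃ H C hε (by ring) h23
    (neg_ne_zero.2 h31) h12' gp1 (by rw [← gp2]; ring) gm3 (by linear_combination -r1)
  have t2 := aux_triple ε (ξ₃ + ξ₁) (-(ξ₁ + ξ₂)) (ξ₂ - ξ₃) lp₂ lp₃ lm₁ H C hε (by ring) h31
    (neg_ne_zero.2 h12) h23' gp2 (by rw [← gp3]; ring) gm1 (by linear_combination -r2)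
  have t3 := aux_triple ε (ξ₁ + ξ₂) (-(ξ₂ + ξ₃)) (ξ₃ - ξ₁) lp₃ lp₁ lm₂ H C hε (by ring) h12
    (neg_ne_zero.2 h23) h31' gp3 (by rw [← gp1]; ring) gm2 (by linear_combination -r3)
  obtain ⟨u₁, hu₁⟩ : ∃ u, lp₁ = (ξ₂ + ξ₃) * u := ⟨lp₁ / (ξ₂ + ξ₃), by field_simp⟩
  obtain ⟨u₂, hu₂⟩ : ∃ u, lp₂ = (ξ₃ + ξ₁) * u := ⟨lp₂ / (ξ₃ + ξ₁), by field_simp⟩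
  obtain ⟨u₃, hu₃⟩ : ∃ u, lp₃ = (ξ₁ + ξ₂) * u := ⟨lp₃ / (ξ₁ + ξ₂), by field_simp⟩
  have s1 : (ξ₁ - ξ₂) * (u₁ * u₂ + ε) = lm₃ * (u₁ - u₂) := by
    apply mul_left_cancel₀ (mul_ne_zero h23 h31)
    rw [hu₁, hu₂] at r1
    linear_combination -r1
  have s2 : (ξ₂ - ξ₃) * (u₂ * u₃ + ε) = lm₁ * (u₂ - u₃) := by
    apply mul_left_cancel₀ (mul_ne_zero h31 h12)
    rw [hu₂, hu₃] at r2
    linear_combination -r2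
  have s3 : (ξ₃ - ξ₁) * (u₃ * u₁ + ε) = lm₂ * (u₃ - u₁) := by
    apply mul_left_cancel₀ (mul_ne_zero h12 h23)
    rw [hu₃, hu₁] at r3
    linear_combination -r3
  have d1 : u₁ - u₂ ≠ 0 := by
    refine aux_ratio ε (ξ₂ + ξ₃) (ξ₃ + ξ₁) u₁ u₂ lm₃ H C hε hH h23 h31 ?_ (hu₁ ▸ gp1)
      (hu₂ ▸ gp2) ?_
    · intro h; apply h12'; linarith
    · linear_combination s1
  have d2 : u₂ - u₃ ≠ 0 := by
    refine aux_ratio ε (ξ₃ + ξ₁) (ξ₁ + ξ₂) u₂ u₃ lm₁ H C hε hH h31 h12 ?_ (hu₂ ▸ gp2)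
      (hu₃ ▸ gp3) ?_
    · intro h; apply h23'; linarith
    · linear_combination s2
  have d3 : u₃ - u₁ ≠ 0 := by
    refine aux_ratio ε (ξ₁ + ξ₂) (ξ₂ + ξ₃) u₃ u₁ lm₂ H C hε hH h12 h23 ?_ (hu₃ ▸ gp3)
      (hu₁ ▸ gp1) ?_
    · intro h; apply h31'; linarith
    · linear_combination s3
  have t4 := aux_triple ε (ξ₁ - ξ₂) (ξ₂ - ξ₃) (ξ₃ - ξ₁) lm₃ lm₁ lm₂ H C hε (by ring) h12'
    h23' h31' gm3 gm1 gm2 (by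
      have e3 : lm₃ = (ξ₁ - ξ₂) * (u₁ * u₂ + ε) / (u₁ - u₂) := by
        rw [eq_div_iff d1, s1]
      have e1 : lm₁ = (ξ₂ - ξ₃) * (u₂ * u₃ + ε) / (u₂ - u₃) := by
        rw [eq_div_iff d2, s2]
      have e2 : lm₂ = (ξ₃ - ξ₁) * (u₃ * u₁ + ε) / (u₃ - u₁) := by
        rw [eq_div_iff d3, s3]
      rw [e1, e2, e3]
      field_simp
      ring)
  have q3 : lm₃ = lp₃ := by
    apply mul_left_cancel₀ hH
    linear_combination (t1 - t2 - t3 + t4) / 2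
  have q1 : lm₁ = lp₁ := by
    apply mul_left_cancel₀ hH
    linear_combination (t2 - t1 - t3 + t4) / 2
  rw [q3] at gm3
  rw [q1] at gm1
  have hε0 : ε ≠ 0 := by rcases hε with h | h <;> rw [h] <;> norm_num
  have z12 : ξ₁ * ξ₂ = 0 := by
    apply mul_left_cancel₀ hε0
    linear_combination (gp3 - gm3) / 4
  have z23 : ξ₂ * ξ₃ = 0 := by
    apply mul_left_cancel₀ hε0
    linear_combination (gp1 - gm1) / 4
  have q2 : lm₂ = lp₂ := by
    apply mul_left_cancel₀ hH
    linear_combination (t3 - t1 - t2 + t4) / 2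
  rw [q2] at gm2
  have z31 : ξ₃ * ξ₁ = 0 := by
    apply mul_left_cancel₀ hε0
    linear_combination (gp2 - gm2) / 4
  rcases mul_eq_zero.1 z12 with h | h
  · rcases mul_eq_zero.1 z23 with h' | h'
    · apply h12; rw [h, h']; norm_num
    · apply h31; rw [h, h']; norm_num
  · rcases mul_eq_zero.1 z31 with h' | h'
    · apply h23; rw [h, h']; norm_num
    · apply h12; rw [h, h']; norm_num
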